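/- There do not exist eleven segments labeled a, b, c, d, e, 1, 2, 3, 4, 8, 9, all of whose 22 endpoints lie on the parabola y = x² and have pairwise distinct x-coordinates appearing in the left-to-right order L₈, L₁, L_a, L_b, L₂, R₈, L_c, L_d, R₁, R₂, L_e, R_a, L₃, L₄, R_b, R_c, L₉, R₃, R_d, R_e, R₄, R₉ (where L_s and R_s denote the left and right endpoints of segment s), such that simultaneously: the segments 8, 1, 2 intersect concavely; the segments 3, 4, 9 intersect concavely; and the segments a, b, c, d, e intersect concavely. -/

import Mathlib

/-- The point of the parabola `y = x²` with x-coordinate `t`. -/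
noncomputable def Ppt (t : ℝ) : ℝ × ℝ := (t, t ^ 2)

/-- The closed straight-line segment between the points of the parabola with
x-coordinates `a` and `b`. -/
noncomputable def Seg (a b : ℝ) : Set (ℝ × ℝ) := segment ℝ (Ppt a) (Ppt b)

/-- For three segments `s₁ = [P aL, P aR]`, `s₂ = [P bL, P bR]`, `s₃ = [P cL, P cR]`
with endpoints on the parabola: the intersection point `s₃ ∩ s₂` lies strictly to
the left of the intersection point `s₂ ∩ s₁`.  A family `s₁, …, sₘ` intersects
concavely exactly when this holds for every three consecutive members. -/
noncomputable def XLt (aL aR bL bR cL cR : ℝ) : Prop :=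
  ∀ z w : ℝ × ℝ, z ∈ Seg cL cR ∩ Seg bL bR → w ∈ Seg bL bR ∩ Seg aL aR → z.1 < w.1

lemma mem_Seg_aux {p q x y : ℝ} (h : p < q) (h1 : p ≤ x) (h2 : x ≤ q)
    (hy : y = (p + q) * x - p * q) : (x, y) ∈ Seg p q := by
  have hd : (0 : ℝ) < q - p := by linarith
  refine ⟨(q - x) / (q - p), (x - p) / (q - p), div_nonneg (by linarith) hd.le,
    div_nonneg (by linarith) hd.le, ?_, ?_⟩
  · field_simp; ring
  · subst hy
    ext
    · simp only [Ppt, Prod.fst_add, Prod.smul_fst, smul_eq_mul]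
      field_simp; ring
    · simp only [Ppt, Prod.snd_add, Prod.smul_snd, smul_eq_mul]
      field_simp; ring

lemma inter_aux {p q r s : ℝ} (h1 : p < r) (h2 : r < q) (h3 : q < s) :
    ∃ y, ((r * s - p * q) / (r + s - p - q), y) ∈ Seg r s ∩ Seg p q := by
  have hd : (0 : ℝ) < r + s - p - q := by linarith
  have a1 : r ≤ (r * s - p * q) / (r + s - p - q) := by
    rw [le_div_iff₀ hd]
    nlinarith [mul_pos (sub_pos.2 h2) (sub_pos.2 h1)]
  have a2 : (r * s - p * q) / (r + s - p - q) ≤ q := by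
    rw [div_le_iff₀ hd]
    nlinarith [mul_pos (sub_pos.2 h2) (sub_pos.2 h3)]
  refine ⟨(p + q) * ((r * s - p * q) / (r + s - p - q)) - p * q, ?_, ?_⟩
  · apply mem_Seg_aux (by linarith) a1 (by linarith)
    field_simp; ring
  · exact mem_Seg_aux (by linarith) (by linarith) a2 rfl

lemma key_aux {p1 p2 p3 q1 q2 q3 : ℝ} (h : XLt p1 q1 p2 q2 p3 q3) (a : p1 < p2) (b : p2 < p3)
    (c : p3 < q1) (d : q1 < q2) (e : q2 < q3) :
    (p3 - p2) * (q2 - q1) * (q3 - p1) < (p2 - p1) * (q1 - p3) * (q3 - q2) := by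
  obtain ⟨y, hy⟩ := inter_aux (p := p2) (q := q2) (r := p3) (s := q3) b (by linarith) e
  obtain ⟨y', hy'⟩ := inter_aux (p := p1) (q := q1) (r := p2) (s := q2) a (by linarith) d
  have := h _ _ hy hy'
  simp only at this
  rw [div_lt_div_iff₀ (by linarith) (by linarith)] at this
  nlinarith [this]

lemma core_aux {a b c d e A B C D E : ℝ} (h1 : a < b) (h2 : b < c) (h3 : c < d) (h4 : d < e)
    (h5 : e < A) (h6 : A < B) (h7 : B < C) (h8 : C < D) (h9 : D < E)
    (k1 : (c - b) * (B - A) * (C - a) < (b - a) * (A - c) * (C - B))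
    (k3 : (e - d) * (D - C) * (E - c) < (d - c) * (C - e) * (E - D))
    (I : (b - a) * (d - c) < (c - b) * (e - d))
    (J : (C - B) * (E - D) < (B - A) * (D - C)) : False := by
  have p1 := sub_pos.2 h1
  have p2 := sub_pos.2 h2
  have p3 := sub_pos.2 h3
  have p4 := sub_pos.2 h4
  have p6 := sub_pos.2 h6
  have p7 := sub_pos.2 h7
  have p8 := sub_pos.2 h8
  have p9 := sub_pos.2 h9
  have q1 : 0 < C - a := by linarith
  have q2 : 0 < E - c := by linarith
  have q3 : 0 < A - c := by linarith
  have q4 : 0 < C - e := by linarith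
  have m1 := mul_lt_mul'' k1 k3 (by positivity) (by positivity)
  have m2 := mul_lt_mul'' I J (by positivity) (by positivity)
  have m3 : (A - c) * (C - e) < (C - a) * (E - c) :=
    mul_lt_mul'' (by linarith) (by linarith) q3.le q4.le
  have m4 := mul_lt_mul'' m2 m3 (by positivity) (by positivity)
  linarith

/-- Theorem `thm_useless_impossible`: there are no eleven segments
`a, b, c, d, e, 1, 2, 3, 4, 8, 9` with all endpoints on the parabola `y = x²`,
whose endpoints appear in the left-to-right order
`L₈ L₁ L_a L_b L₂ R₈ L_c L_d R₁ R₂ L_e R_a L₃ L₄ R_b R_c L₉ R₃ R_d R_e R₄ R₉`,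
such that segments `8, 1, 2` intersect concavely, segments `3, 4, 9` intersect
concavely, and segments `a, b, c, d, e` intersect concavely. -/
theorem thm_useless_impossible :
    ¬ ∃ l8 l1 la lb l2 r8 lc ld r1 r2 le ra l3 l4 rb rc l9 r3 rd re r4 r9 : ℝ,
      (l8 < l1 ∧ l1 < la ∧ la < lb ∧ lb < l2 ∧ l2 < r8 ∧ r8 < lc ∧ lc < ld ∧
        ld < r1 ∧ r1 < r2 ∧ r2 < le ∧ le < ra ∧ ra < l3 ∧ l3 < l4 ∧ l4 < rb ∧
        rb < rc ∧ rc < l9 ∧ l9 < r3 ∧ r3 < rd ∧ rd < re ∧ re < r4 ∧ r4 < r9) ∧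
      -- segments 8, 1, 2 intersect concavely
      XLt l8 r8 l1 r1 l2 r2 ∧
      -- segments 3, 4, 9 intersect concavely
      XLt l3 r3 l4 r4 l9 r9 ∧
      -- segments a, b, c, d, e intersect concavely
      XLt la ra lb rb lc rc ∧ XLt lb rb lc rc ld rd ∧ XLt lc rc ld rd le re := by
  rintro ⟨l8, l1, la, lb, l2, r8, lc, ld, r1, r2, le, ra, l3, l4, rb, rc, l9, r3, rd, re, r4, r9,
    ⟨o1, o2, o3, o4, o5, o6, o7, o8, o9, o10, o11, o12, o13, o14, o15, o16, o17, o18, o19, o20, o21⟩,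
    x1, x2, x3, x4, x5⟩
  have k1 := key_aux x1 (by linarith) (by linarith) (by linarith) (by linarith) (by linarith)
  have k2 := key_aux x2 (by linarith) (by linarith) (by linarith) (by linarith) (by linarith)
  have k3 := key_aux x3 (by linarith) (by linarith) (by linarith) (by linarith) (by linarith)
  have k5 := key_aux x5 (by linarith) (by linarith) (by linarith) (by linarith) (by linarith)
  refine core_aux o3 (by linarith) o7 (by linarith) o11 (by linarith) o15 (by linarith) o19 k3 k5 ?_ ?_
  · have t1 : (l2 - l1) * (r1 - r8) < (r8 - l2) * (r2 - r1) := by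
      have u : 0 < (r8 - l2) * (r2 - r1) := mul_pos (by linarith) (by linarith)
      have v : 0 < r2 - l8 := by linarith
      have w : (l1 - l8) * ((r8 - l2) * (r2 - r1)) < (r2 - l8) * ((r8 - l2) * (r2 - r1)) :=
        mul_lt_mul_of_pos_right (by linarith) u
      refine lt_of_mul_lt_mul_left ?_ v.le
      linarith
    have t2 : (lb - la) * (ld - lc) < (l2 - l1) * (r1 - r8) :=
      mul_lt_mul'' (by linarith) (by linarith) (by linarith) (by linarith)
    have t3 : (r8 - l2) * (r2 - r1) < (lc - lb) * (le - ld) :=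
      mul_lt_mul'' (by linarith) (by linarith) (by linarith) (by linarith)
    linarith
  · have t1 : (l9 - l4) * (r4 - r3) < (l4 - l3) * (r3 - l9) := by
      have u : 0 < (l4 - l3) * (r3 - l9) := mul_pos (by linarith) (by linarith)
      have v : 0 < r9 - l3 := by linarith
      have w : (r9 - r4) * ((l4 - l3) * (r3 - l9)) < (r9 - l3) * ((l4 - l3) * (r3 - l9)) :=
        mul_lt_mul_of_pos_right (by linarith) u
      refine lt_of_mul_lt_mul_left ?_ v.le
      linarith
    have t2 : (rc - rb) * (re - rd) < (l9 - l4) * (r4 - r3) :=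
      mul_lt_mul'' (by linarith) (by linarith) (by linarith) (by linarith)
    have t3 : (l4 - l3) * (r3 - l9) < (rb - ra) * (rd - rc) :=
      mul_lt_mul'' (by linarith) (by linarith) (by linarith) (by linarith)
    linarith
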